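/- Let p > 3 be a prime and let χ₃(p) = 1 if p ≡ 1 (mod 3) and χ₃(p) = -1 if p ≡ 2 (mod 3) (the Legendre symbol (p/3)). Then χ₃(p) · Σ_{k=0}^{p-1} binom(2k,k)·binom(3k,k)/27^k · H_k ≡ -3·q_p(3) + (3/2)·p·q_p(3)² (mod p²). -/

import Mathlib

open Finset

/-- Generalized binomial coefficient `C(a,k) = a(a-1)⋯(a-k+1)/k!` for a rational `a`. -/
noncomputable def gchoose (a : ℚ) (k : ℕ) : ℚ :=
  (∏ j ∈ Finset.range k, (a - j)) / (Nat.factorial k : ℚ)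

/-- The harmonic number `H_k = ∑_{j=1}^k 1/j`. -/
def harm (k : ℕ) : ℚ := ∑ j ∈ Finset.range k, (1 : ℚ) / (j + 1)

/-- The second-order harmonic number `H_k^{(2)} = ∑_{j=1}^k 1/j²`. -/
def harm2 (k : ℕ) : ℚ := ∑ j ∈ Finset.range k, (1 : ℚ) / (j + 1) ^ 2

/-- `x ≡ y (mod p^m)` for rationals: the p-adic valuation of `x - y` is at least `m`
(with the convention that the valuation of `0` is `+∞`). -/
def CongrMod (p m : ℕ) (x y : ℚ) : Prop :=
  x = y ∨ (m : ℤ) ≤ padicValRat p (x - y)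

/-- The Bernoulli polynomial `B_n` evaluated at a rational `x`. -/
noncomputable def bpoly (n : ℕ) (x : ℚ) : ℚ := (Polynomial.bernoulli n).eval x

/-- The Euler polynomial `E_n` evaluated at a rational `x`, via
`E_n(x) = (2/(n+1))·(B_{n+1}(x) − 2^{n+1}·B_{n+1}(x/2))`. -/
noncomputable def epoly (n : ℕ) (x : ℚ) : ℚ :=
  (2 / (n + 1 : ℚ)) * (bpoly (n + 1) x - 2 ^ (n + 1) * bpoly (n + 1) (x / 2))

/-- The Euler number `E_n = 2^n · E_n(1/2)`. -/
noncomputable def eulerNum (n : ℕ) : ℚ := 2 ^ n * epoly n (1 / 2)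

/-- The `p`-adic valuation of `x` is at least `m`, expressed through the `p`-adic norm. -/
def DivPow (p m : ℕ) (x : ℚ) : Prop := padicNorm p x ≤ (p : ℚ) ^ (-(m : ℤ))

namespace DivPow

variable {p m n : ℕ} {x y : ℚ}

theorem zero : DivPow p m 0 := by
  simp only [DivPow, padicNorm.zero]
  positivity

theorem neg (hx : DivPow p m x) : DivPow p m (-x) := by
  simpa [DivPow, padicNorm.neg] using hx

variable [hp : Fact p.Prime]

theorem congrMod (h : DivPow p m (x - y)) : CongrMod p m x y := by
  by_cases hxy : x = y
  · exact Or.inl hxy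
  · right
    have h1 : (1 : ℚ) < p := by exact_mod_cast hp.out.one_lt
    have h0 : x - y ≠ 0 := sub_ne_zero.mpr hxy
    unfold DivPow at h
    rw [padicNorm.eq_zpow_of_nonzero h0, zpow_le_zpow_iff_right₀ h1] at h
    linarith

theorem add (hx : DivPow p m x) (hy : DivPow p m y) : DivPow p m (x + y) :=
  padicNorm.nonarchimedean.trans (max_le hx hy)

theorem sub (hx : DivPow p m x) (hy : DivPow p m y) : DivPow p m (x - y) := by
  rw [sub_eq_add_neg]
  exact hx.add hy.neg

theorem mul (hx : DivPow p m x) (hy : DivPow p n y) : DivPow p (m + n) (x * y) := by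
  have h0 : (p : ℚ) ≠ 0 := by exact_mod_cast hp.out.ne_zero
  unfold DivPow at *
  rw [padicNorm.mul]
  have : (-((m + n : ℕ) : ℤ)) = -(m : ℤ) + -(n : ℤ) := by push_cast; ring
  rw [this, zpow_add₀ h0]
  exact mul_le_mul hx hy (padicNorm.nonneg _) (by positivity)

theorem mul_integral (hx : DivPow p m x) (hy : DivPow p 0 y) : DivPow p m (x * y) :=
  hx.mul hy

theorem integral_mul (hx : DivPow p 0 x) (hy : DivPow p m y) : DivPow p m (x * y) := by
  rw [mul_comm]
  exact hy.mul hx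

theorem mono (hx : DivPow p m x) (h : n ≤ m) : DivPow p n x := by
  have h1 : (1 : ℚ) ≤ p := by exact_mod_cast hp.out.one_le
  exact hx.trans (zpow_le_zpow_right₀ h1 (by simpa using h))

theorem sum {ι : Type*} {s : Finset ι} {f : ι → ℚ} (h : ∀ i ∈ s, DivPow p m (f i)) :
    DivPow p m (∑ i ∈ s, f i) :=
  Finset.sum_induction f (DivPow p m) (fun _ _ => add) zero h

theorem intCast (z : ℤ) : DivPow p 0 (z : ℚ) := by
  simpa [DivPow] using padicNorm.of_int z

theorem natCast (z : ℕ) : DivPow p 0 (z : ℚ) := by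
  exact_mod_cast intCast (p := p) z

theorem one : DivPow p 0 1 := by exact_mod_cast natCast (p := p) 1

theorem prod {ι : Type*} {s : Finset ι} {f : ι → ℚ} (h : ∀ i ∈ s, DivPow p 0 (f i)) :
    DivPow p 0 (∏ i ∈ s, f i) :=
  Finset.prod_induction f (DivPow p 0) (fun _ _ => mul) one h

theorem prod_of_mem {ι : Type*} [DecidableEq ι] {s : Finset ι} {f : ι → ℚ} {i : ι} (hi : i ∈ s)
    (h : DivPow p m (f i)) (h0 : ∀ i ∈ s, DivPow p 0 (f i)) :
    DivPow p m (∏ i ∈ s, f i) := by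
  rw [← Finset.mul_prod_erase s f hi]
  exact h.mul_integral (prod fun j hj => h0 j (Finset.mem_of_mem_erase hj))

theorem prime : DivPow p 1 (p : ℚ) := by
  simp [DivPow, padicNorm.padicNorm_p_of_prime]

theorem inv_intCast {z : ℤ} (hz : ¬ (p : ℤ) ∣ z) : DivPow p 0 ((z : ℚ)⁻¹) := by
  have h1 : padicNorm p (z : ℚ) = 1 := (padicNorm.int_eq_one_iff z).mpr hz
  have h0 : (z : ℚ) ≠ 0 := by
    rintro h
    simp [h] at h1
  have h2 : padicNorm p (z : ℚ) * padicNorm p ((z : ℚ)⁻¹) = 1 := by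
    rw [← padicNorm.mul, mul_inv_cancel₀ h0, padicNorm.one]
  rw [h1, one_mul] at h2
  simp [DivPow, h2]

theorem inv_natCast {z : ℕ} (hz : ¬ p ∣ z) : DivPow p 0 ((z : ℚ)⁻¹) := by
  have := inv_intCast (p := p) (z := z) (by exact_mod_cast hz)
  exact_mod_cast this

theorem inv_succ {j : ℕ} (hj : j < p - 1) : DivPow p 0 (((j : ℚ) + 1)⁻¹) := by
  have := inv_natCast (p := p) (z := j + 1) (Nat.not_dvd_of_pos_of_lt (by omega) (by omega))
  exact_mod_cast this

/-- Cancel a factor prime to `p`. -/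
theorem of_natCast_mul {z : ℕ} (hz : ¬ p ∣ z) (h : DivPow p m ((z : ℚ) * x)) : DivPow p m x := by
  have h0 : (z : ℚ) ≠ 0 := by
    rintro h0
    exact hz (by simp [Nat.cast_eq_zero.mp h0])
  have := (inv_natCast hz).integral_mul h
  rwa [inv_mul_cancel_left₀ h0] at this

/-- Cancel a factor `p`. -/
theorem of_prime_mul (h : DivPow p (m + 1) ((p : ℚ) * x)) : DivPow p m x := by
  have h0 : (0 : ℚ) < p := by exact_mod_cast hp.out.pos
  unfold DivPow at *
  rw [padicNorm.mul, padicNorm.padicNorm_p_of_prime] at h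
  have : (-((m + 1 : ℕ) : ℤ)) = -(m : ℤ) - 1 := by push_cast; ring
  rw [this, zpow_sub_one₀ h0.ne', mul_comm] at h
  exact le_of_mul_le_mul_right h (by positivity)

end DivPow

section Identities

/-- The product `∏_{j=1}^k (1 - c²/j²)`. -/
def sinProd (c : ℚ) (k : ℕ) : ℚ := ∏ j ∈ range k, (1 - c ^ 2 / ((j : ℚ) + 1) ^ 2)

/-- The product `binom(c, k) * binom(-1-c, k)`. -/
def legTerm (c : ℚ) (k : ℕ) : ℚ :=
  ∏ j ∈ range k, (-((c - j) * (c + j + 1)) / ((j : ℚ) + 1) ^ 2)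

theorem legTerm_succ (c : ℚ) (k : ℕ) :
    legTerm c (k + 1) = -(c * (c + k + 1)) / ((k : ℚ) + 1) ^ 2 * sinProd c k := by
  induction k with
  | zero => simp [legTerm, sinProd]
  | succ k ih =>
    rw [legTerm, prod_range_succ, ← legTerm, ih, sinProd, sinProd, prod_range_succ]
    have h1 : (k : ℚ) + 1 ≠ 0 := by positivity
    have h2 : (k : ℚ) + 1 + 1 ≠ 0 := by positivity
    push_cast
    field_simp
    ring

theorem legTerm_neg_one_sub (c : ℚ) (k : ℕ) : legTerm (-1 - c) k = legTerm c k := by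
  unfold legTerm
  refine prod_congr rfl fun j _ => ?_
  congr 1
  ring

theorem legTerm_sub_one_succ (c : ℚ) (k : ℕ) :
    legTerm (c - 1) (k + 1) = -(c * (c - k - 1)) / ((k : ℚ) + 1) ^ 2 * sinProd c k := by
  have h : legTerm (c - 1) (k + 1) = legTerm (-c) (k + 1) := by
    rw [← legTerm_neg_one_sub]
    congr 1
    ring
  have h2 : sinProd (-c) k = sinProd c k := by simp [sinProd]
  rw [h, legTerm_succ, h2]
  congr 2
  ring

theorem sinProd_succ (c : ℚ) (k : ℕ) :
    sinProd c (k + 1) = sinProd c k * (1 - c ^ 2 / ((k : ℚ) + 1) ^ 2) :=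
  prod_range_succ _ _

theorem harm_succ (k : ℕ) : harm (k + 1) = harm k + 1 / ((k : ℚ) + 1) :=
  sum_range_succ _ _

theorem harm2_succ (k : ℕ) : harm2 (k + 1) = harm2 k + 1 / ((k : ℚ) + 1) ^ 2 :=
  sum_range_succ _ _

theorem sum_legTerm_add (c : ℚ) (N : ℕ) :
    ∑ k ∈ range (N + 1), legTerm c k + ∑ k ∈ range (N + 1), legTerm (c - 1) k
      = 2 * sinProd c N := by
  induction N with
  | zero => simp [legTerm, sinProd]; norm_num
  | succ N ih =>
    rw [sum_range_succ, sum_range_succ _ (N + 1), legTerm_succ, legTerm_sub_one_succ, sinProd_succ]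
    have h1 : (N : ℚ) + 1 ≠ 0 := by positivity
    have : ∀ a b c d : ℚ, a + b + (c + d) = a + c + (b + d) := by intros; ring
    rw [this, ih]
    field_simp
    ring

theorem sum_legTerm_mul_harm_add (c : ℚ) (N : ℕ) :
    c * (∑ k ∈ range (N + 1), legTerm c k * harm k
        + ∑ k ∈ range (N + 1), legTerm (c - 1) k * harm k)
      = 2 * (c * sinProd c N * harm N - sinProd c N + ∑ k ∈ range (N + 1), legTerm c k) := by
  induction N with
  | zero => simp [legTerm, sinProd, harm]
  | succ N ih =>
    rw [sum_range_succ, sum_range_succ _ (N + 1), sum_range_succ (fun k => legTerm c k) (N + 1)]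
    have : ∀ a b c d : ℚ, a + b + (c + d) = a + c + (b + d) := by intros; ring
    rw [this, mul_add, ih, legTerm_succ, legTerm_sub_one_succ, sinProd_succ, harm_succ]
    have h1 : (N : ℚ) + 1 ≠ 0 := by positivity
    field_simp
    ring

theorem sum_harm_div (N : ℕ) :
    2 * ∑ k ∈ range N, harm (k + 1) / ((k : ℚ) + 1) = harm N ^ 2 + harm2 N := by
  induction N with
  | zero => simp [harm, harm2]
  | succ N ih =>
    rw [sum_range_succ, mul_add, ih, harm_succ, harm2_succ]
    have h1 : (N : ℚ) + 1 ≠ 0 := by positivity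
    field_simp
    ring

theorem choose_mul_choose_div_eq_legTerm (k : ℕ) :
    (Nat.choose (2 * k) k : ℚ) * (Nat.choose (3 * k) k) / 27 ^ k = legTerm (-1 / 3) k := by
  have key : ∀ k : ℕ, (Nat.choose (2 * k) k : ℚ) * (Nat.choose (3 * k) k)
      = (3 * k).factorial / (k.factorial : ℚ) ^ 3 := by
    intro k
    have h1 := Nat.choose_mul_factorial_mul_factorial (n := 2 * k) (k := k) (by omega)
    have h2 := Nat.choose_mul_factorial_mul_factorial (n := 3 * k) (k := k) (by omega)
    rw [show 2 * k - k = k by omega] at h1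
    rw [show 3 * k - k = 2 * k by omega, ← h1] at h2
    have h3 : (k.factorial : ℚ) ≠ 0 := by exact_mod_cast k.factorial_ne_zero
    rw [eq_div_iff (by positivity), ← h2]
    push_cast
    ring
  rw [key]
  induction k with
  | zero => simp [legTerm]
  | succ k ih =>
    rw [legTerm, prod_range_succ, ← legTerm, ← ih, show 3 * (k + 1) = 3 * k + 1 + 1 + 1 by ring,
      Nat.factorial_succ, Nat.factorial_succ, Nat.factorial_succ, Nat.factorial_succ]
    have h3 : (k.factorial : ℚ) ≠ 0 := by exact_mod_cast k.factorial_ne_zero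
    have h1 : (k : ℚ) + 1 ≠ 0 := by positivity
    push_cast
    field_simp
    ring

end Identities

section Congruences

theorem cast_reflect {p j : ℕ} (hj : j < p - 1) : ((p - 1 - 1 - j : ℕ) : ℚ) + 1 = p - (j + 1) := by
  have : p - 1 - 1 - j + 1 + (j + 1) = p := by omega
  rw [eq_sub_iff_add_eq]
  exact_mod_cast this

theorem cast_three_mul_divMod (p j : ℕ) :
    ((3 * (j + 1) % p : ℕ) : ℚ) + p * ((3 * (j + 1) / p : ℕ) : ℚ) = 3 * ((j : ℚ) + 1) := by
  exact_mod_cast Nat.mod_add_div (3 * (j + 1)) p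

variable {p : ℕ} [hp : Fact p.Prime]

theorem divPow_harm_of_le {k : ℕ} (hk : k ≤ p - 1) : DivPow p 0 (harm k) := by
  refine DivPow.sum fun j hj => ?_
  rw [one_div]
  exact DivPow.inv_succ (by have := mem_range.mp hj; omega)

theorem divPow_harm_pred (h2 : 2 < p) : DivPow p 1 (harm (p - 1)) := by
  have hnd : ¬ p ∣ 2 := Nat.not_dvd_of_pos_of_lt (by omega) h2
  refine DivPow.of_natCast_mul hnd ?_
  have h : ((2 : ℕ) : ℚ) * harm (p - 1) = ∑ j ∈ range (p - 1),
      (p : ℚ) * (((j : ℚ) + 1)⁻¹ * (((p - 1 - 1 - j : ℕ) : ℚ) + 1)⁻¹) := by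
    have h3 : ((2 : ℕ) : ℚ) * harm (p - 1) = harm (p - 1) + harm (p - 1) := by push_cast; ring
    rw [h3]
    nth_rewrite 2 [harm]
    rw [← sum_range_reflect, harm, ← sum_add_distrib]
    refine sum_congr rfl fun j hj => ?_
    have hj' := mem_range.mp hj
    have h1 : (j : ℚ) + 1 ≠ 0 := by positivity
    have h2 : ((p - 1 - 1 - j : ℕ) : ℚ) + 1 ≠ 0 := by positivity
    have h4 : (p : ℚ) = (((p - 1 - 1 - j : ℕ) : ℚ) + 1) + (j + 1) := by
      rw [cast_reflect hj']; ring
    rw [h4]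
    field_simp
  rw [h]
  refine DivPow.sum fun j hj => ?_
  have hj' := mem_range.mp hj
  exact DivPow.prime.mul_integral
    ((DivPow.inv_succ hj').mul_integral (DivPow.inv_succ (by omega)))

@[to_additive]
theorem prod_triple_mod {M : Type*} [CommMonoid M] (h3 : 3 < p) (f : ℕ → M) :
    ∏ j ∈ range (p - 1), f (3 * (j + 1) % p) = ∏ j ∈ range (p - 1), f (j + 1) := by
  have hnd : ¬ p ∣ 3 := Nat.not_dvd_of_pos_of_lt (by omega) h3
  have hpos : ∀ j ∈ range (p - 1), 0 < 3 * (j + 1) % p := by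
    intro j hj
    have hj' := mem_range.mp hj
    rw [Nat.pos_iff_ne_zero]
    intro h
    rcases hp.out.dvd_mul.mp (Nat.dvd_of_mod_eq_zero h) with h | h
    · exact hnd h
    · exact Nat.not_dvd_of_pos_of_lt (by omega) (by omega) h
  have hlt : ∀ j, 3 * (j + 1) % p < p := fun j => Nat.mod_lt _ hp.out.pos
  have hmaps : ∀ j ∈ range (p - 1), 3 * (j + 1) % p - 1 ∈ range (p - 1) := by
    intro j hj
    have := hpos j hj
    have := hlt j
    rw [mem_range]
    omega
  have hinj : Set.InjOn (fun j => 3 * (j + 1) % p - 1) (range (p - 1)) := by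
    intro i hi j hj hij
    have h1 := hpos i hi
    have h2 := hpos j hj
    have h : 3 * (i + 1) % p = 3 * (j + 1) % p := by
      simp only at hij
      omega
    have hc : Nat.Coprime p 3 := (Nat.Prime.coprime_iff_not_dvd hp.out).mpr hnd
    have h4 : i + 1 ≡ j + 1 [MOD p] := Nat.ModEq.cancel_left_of_coprime hc h
    have hi' := mem_range.mp (mem_coe.mp hi)
    have hj' := mem_range.mp (mem_coe.mp hj)
    have := Nat.ModEq.eq_of_lt_of_lt h4 (by omega) (by omega)
    omega
  refine prod_nbij (fun j => 3 * (j + 1) % p - 1) hmaps hinj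
    (surjOn_of_injOn_of_card_le _ hmaps hinj le_rfl) ?_
  intro j hj
  have := hpos j hj
  congr 1
  omega

/-- Multiplication by `3` permutes the nonzero residues: the remainder and the quotient of
`3 * (j + 1)` by `p`, and their behaviour under `j + 1 ↦ p - (j + 1)`. -/
theorem three_mul_divMod (h3 : 3 < p) {j : ℕ} (hj : j < p - 1) :
    0 < 3 * (j + 1) % p ∧ 3 * (j + 1) % p < p ∧ 3 * (j + 1) / p ≤ 2 ∧
      3 * (p - 1 - 1 - j + 1) % p = p - 3 * (j + 1) % p ∧
      3 * (p - 1 - 1 - j + 1) / p = 2 - 3 * (j + 1) / p := by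
  have hnd : ¬ p ∣ 3 := Nat.not_dvd_of_pos_of_lt (by omega) h3
  have h1 : 0 < 3 * (j + 1) % p := by
    rw [Nat.pos_iff_ne_zero]
    intro h
    rcases hp.out.dvd_mul.mp (Nat.dvd_of_mod_eq_zero h) with h | h
    · exact hnd h
    · exact Nat.not_dvd_of_pos_of_lt (by omega) (by omega) h
  have h2 : 3 * (j + 1) % p < p := Nat.mod_lt _ hp.out.pos
  have h4 : 3 * (j + 1) / p < 3 := Nat.div_lt_of_lt_mul (by omega)
  have h5 := Nat.mod_add_div (3 * (j + 1)) p
  have h6 : 3 * (p - 1 - 1 - j + 1) + 3 * (j + 1) = 3 * p := by omega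
  set r := 3 * (j + 1) % p
  set s := 3 * (j + 1) / p
  have h7 : 3 * (p - 1 - 1 - j + 1) = (p - r) + p * (2 - s) := by
    interval_cases s <;> omega
  refine ⟨h1, h2, by omega, ?_, ?_⟩
  · rw [h7, Nat.add_mul_mod_self_left, Nat.mod_eq_of_lt (by omega)]
  · rw [h7, Nat.add_mul_div_left _ _ hp.out.pos, Nat.div_eq_of_lt (by omega), zero_add]

theorem divPow_harm2_pred (h3 : 3 < p) : DivPow p 1 (harm2 (p - 1)) := by
  have hnd2 : ¬ p ∣ 2 := Nat.not_dvd_of_pos_of_lt (by omega) (by omega)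
  have hnd : ¬ p ∣ 2 ^ 3 := fun h => hnd2 (hp.out.dvd_of_dvd_pow h)
  refine DivPow.of_natCast_mul hnd ?_
  have hperm := sum_triple_mod h3 (fun r => ((r : ℚ)⁻¹) ^ 2)
  have h : ((2 ^ 3 : ℕ) : ℚ) * harm2 (p - 1) = ∑ j ∈ range (p - 1),
      (p : ℚ) * (((3 * (j + 1) / p : ℕ) : ℚ) * (3 * ((j : ℚ) + 1) + (3 * (j + 1) % p : ℕ))
        * ((((j : ℚ) + 1)⁻¹) ^ 2 * (((3 * (j + 1) % p : ℕ) : ℚ)⁻¹) ^ 2)) := by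
    have h1 : harm2 (p - 1) = ∑ j ∈ range (p - 1), (((j + 1 : ℕ) : ℚ)⁻¹) ^ 2 := by
      simp [harm2]
    have h2 : ((2 ^ 3 : ℕ) : ℚ) * harm2 (p - 1) = 9 * harm2 (p - 1) - harm2 (p - 1) := by
      push_cast; ring
    rw [h2]
    nth_rewrite 1 [h1]
    rw [← hperm, harm2, mul_sum, ← sum_sub_distrib]
    refine sum_congr rfl fun j hj => ?_
    obtain ⟨h1, -, -⟩ := three_mul_divMod h3 (mem_range.mp hj)
    have h5 := cast_three_mul_divMod p j
    have h6 : ((3 * (j + 1) % p : ℕ) : ℚ) ≠ 0 := by exact_mod_cast h1.ne'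
    have h7 : (j : ℚ) + 1 ≠ 0 := by positivity
    generalize ((3 * (j + 1) % p : ℕ) : ℚ) = r at *
    generalize ((3 * (j + 1) / p : ℕ) : ℚ) = s at *
    field_simp
    linear_combination (-(3 * ((j : ℚ) + 1) + r)) * h5
  rw [h]
  refine DivPow.sum fun j hj => ?_
  have hj' := mem_range.mp hj
  obtain ⟨h1, h2, -⟩ := three_mul_divMod h3 hj'
  refine DivPow.prime.mul_integral (DivPow.mul (m := 0) (n := 0) ?_ ?_)
  · exact_mod_cast DivPow.natCast (p := p) (3 * (j + 1) / p * (3 * (j + 1) + 3 * (j + 1) % p))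
  · have hr := DivPow.inv_natCast (Nat.not_dvd_of_pos_of_lt h1 h2)
    rw [pow_two, pow_two]
    exact ((DivPow.inv_succ hj').mul (DivPow.inv_succ hj')).mul (hr.mul hr)

theorem divPow_prod_one_add_prime_mul {ι : Type*} [DecidableEq ι] (h2 : 2 < p) (s : Finset ι)
    {x : ι → ℚ} (hx : ∀ i ∈ s, DivPow p 0 (x i)) :
    DivPow p 3 (∏ i ∈ s, (1 + p * x i) - (1 + p * ∑ i ∈ s, x i
      + p ^ 2 * (((∑ i ∈ s, x i) ^ 2 - ∑ i ∈ s, x i ^ 2) / 2))) := by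
  have hhalf : DivPow p 0 ((2 : ℚ)⁻¹) := by
    exact_mod_cast DivPow.inv_natCast (p := p) (Nat.not_dvd_of_pos_of_lt two_pos h2)
  induction s using Finset.induction_on with
  | empty => simpa using DivPow.zero
  | insert a s ha ih =>
    have hs : ∀ i ∈ s, DivPow p 0 (x i) := fun i hi => hx i (mem_insert_of_mem hi)
    have hxa := hx a (mem_insert_self a s)
    have hE : DivPow p 0 (∑ i ∈ s, x i) := DivPow.sum hs
    have hQ : DivPow p 0 (∑ i ∈ s, x i ^ 2) := DivPow.sum fun i hi => by
      rw [pow_two]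
      exact (hs i hi).mul (hs i hi)
    rw [prod_insert ha, sum_insert ha, sum_insert ha]
    have ih' := ih hs
    generalize ∏ i ∈ s, (1 + p * x i) = P at *
    generalize ∑ i ∈ s, x i = E at *
    generalize ∑ i ∈ s, x i ^ 2 = Q at *
    have h1 : DivPow p 0 (1 + p * x a) :=
      DivPow.one.add ((DivPow.natCast p).mul hxa)
    have h3 : DivPow p 3 ((p : ℚ) * p * p * (x a * ((E * E - Q) * 2⁻¹))) :=
      ((DivPow.prime.mul DivPow.prime).mul DivPow.prime).mul_integral
        (hxa.mul (((hE.mul hE).sub hQ).mul hhalf))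
    convert (h1.integral_mul ih').add h3 using 1
    ring

theorem three_pow_eq_prod (h3 : 3 < p) :
    (3 : ℚ) ^ (p - 1) = ∏ j ∈ range (p - 1),
      (1 + (p : ℚ) * (((3 * (j + 1) / p : ℕ) : ℚ) * ((3 * (j + 1) % p : ℕ) : ℚ)⁻¹)) := by
  have hperm := prod_triple_mod h3 (fun r => (r : ℚ))
  have h0 : ∏ j ∈ range (p - 1), (((j + 1 : ℕ)) : ℚ) ≠ 0 :=
    prod_ne_zero_iff.mpr fun j _ => by positivity
  refine mul_right_cancel₀ h0 ?_
  nth_rewrite 2 [← hperm]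
  rw [← prod_mul_distrib, ← card_range (p - 1), ← prod_const, card_range, ← prod_mul_distrib]
  refine prod_congr rfl fun j hj => ?_
  obtain ⟨h1, -, -⟩ := three_mul_divMod h3 (mem_range.mp hj)
  have h5 := cast_three_mul_divMod p j
  have h6 : ((3 * (j + 1) % p : ℕ) : ℚ) ≠ 0 := by exact_mod_cast h1.ne'
  push_cast at *
  field_simp
  linear_combination -h5

/-- Symmetrization of a sum over `range (p - 1)` under `j ↦ p - 2 - j`. -/
theorem two_mul_sum_eq_sum_add_reflect {N : ℕ} (f : ℕ → ℚ) :
    2 * ∑ j ∈ range N, f j = ∑ j ∈ range N, (f j + f (N - 1 - j)) := by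
  rw [sum_add_distrib, sum_range_reflect, two_mul]

theorem sum_quotient_eq (h3 : 3 < p) :
    ∑ j ∈ range (p - 1), ((3 * (j + 1) / p : ℕ) : ℚ) * (((3 * (j + 1) / p : ℕ) : ℚ) - 1) / 2
        * ((3 * (j + 1) % p : ℕ) : ℚ)⁻¹
      = ∑ i ∈ range (p / 3), ((p : ℚ) - 3 * (i + 1))⁻¹ := by
  rw [← sum_range_reflect]
  symm
  have hsub : range (p / 3) ⊆ range (p - 1) := range_subset_range.mpr (by omega)
  have hnd : ¬ 3 ∣ p := by
    intro h
    have := (Nat.prime_dvd_prime_iff_eq Nat.prime_three hp.out).mp h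
    omega
  rw [← sum_subset hsub]
  · refine sum_congr rfl fun j hj => ?_
    have hj1 := mem_range.mp hj
    obtain ⟨-, -, -, h4, h5⟩ := three_mul_divMod h3 (mem_range.mp (hsub hj))
    have hlt : 3 * (j + 1) < p := by omega
    rw [h4, h5, Nat.div_eq_of_lt hlt, Nat.mod_eq_of_lt hlt, Nat.cast_sub hlt.le]
    push_cast
    norm_num
  · intro j hj hj2
    have hj1 : ¬ j < p / 3 := fun h => hj2 (mem_range.mpr h)
    obtain ⟨-, -, h, h4, h5⟩ := three_mul_divMod h3 (mem_range.mp hj)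
    rw [h5]
    have h6 : 1 ≤ 3 * (j + 1) / p := (Nat.one_le_div_iff hp.out.pos).mpr (by omega)
    interval_cases 3 * (j + 1) / p <;> simp

theorem divPow_log_three_sub (h3 : 3 < p) :
    DivPow p 2 (∑ j ∈ range (p - 1),
        ((3 * (j + 1) / p : ℕ) : ℚ) * ((3 * (j + 1) % p : ℕ) : ℚ)⁻¹
      - p / 2 * ∑ j ∈ range (p - 1),
        (((3 * (j + 1) / p : ℕ) : ℚ) * ((3 * (j + 1) % p : ℕ) : ℚ)⁻¹) ^ 2
      - 2 * ∑ i ∈ range (p / 3), ((p : ℚ) - 3 * (i + 1))⁻¹) := by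
  rw [← sum_quotient_eq h3]
  have hperm : ∑ j ∈ range (p - 1), (((3 * (j + 1) % p : ℕ) : ℚ)⁻¹) ^ 2 = harm2 (p - 1) := by
    rw [sum_triple_mod h3 (fun r => ((r : ℚ)⁻¹) ^ 2)]
    simp [harm2]
  have hH := divPow_harm2_pred h3
  rw [← hperm] at hH
  set r : ℕ → ℚ := fun j => ((3 * (j + 1) % p : ℕ) : ℚ) with hr
  set s : ℕ → ℚ := fun j => ((3 * (j + 1) / p : ℕ) : ℚ) with hs
  change DivPow p 1 (∑ j ∈ range (p - 1), ((r j)⁻¹) ^ 2) at hH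
  change DivPow p 2 (∑ j ∈ range (p - 1), s j * (r j)⁻¹
    - p / 2 * ∑ j ∈ range (p - 1), (s j * (r j)⁻¹) ^ 2
    - 2 * ∑ j ∈ range (p - 1), s j * (s j - 1) / 2 * (r j)⁻¹)
  have hrefl : ∀ j ∈ range (p - 1), r (p - 1 - 1 - j) = p - r j ∧ s (p - 1 - 1 - j) = 2 - s j := by
    intro j hj
    obtain ⟨-, h2, h, h4, h5⟩ := three_mul_divMod h3 (mem_range.mp hj)
    simp only [hr, hs]
    rw [h4, h5, Nat.cast_sub h2.le, Nat.cast_sub h]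
    simp
  have hr0 : ∀ j ∈ range (p - 1), r j ≠ 0 ∧ (p : ℚ) - r j ≠ 0 := by
    intro j hj
    obtain ⟨h1, h2, -⟩ := three_mul_divMod h3 (mem_range.mp hj)
    refine ⟨by simp only [hr]; exact_mod_cast h1.ne', sub_ne_zero.mpr ?_⟩
    simp only [hr]
    exact_mod_cast h2.ne'
  have hri : ∀ j ∈ range (p - 1), DivPow p 0 (r j)⁻¹ := by
    intro j hj
    obtain ⟨h1, h2, -⟩ := three_mul_divMod h3 (mem_range.mp hj)
    exact DivPow.inv_natCast (Nat.not_dvd_of_pos_of_lt h1 h2)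
  have hri' : ∀ j ∈ range (p - 1), DivPow p 0 ((p : ℚ) - r j)⁻¹ := by
    intro j hj
    rw [← (hrefl j hj).1]
    exact hri _ (mem_range.mpr (by have := mem_range.mp hj; omega))
  have hri2 : ∀ j, DivPow p 0 (r j) := fun j => DivPow.natCast _
  have hsi : ∀ j, DivPow p 0 (s j) := fun j => DivPow.natCast _
  have htwo : DivPow p 0 (2 : ℚ) := by exact_mod_cast DivPow.natCast (p := p) 2
  have hnd2 : ¬ p ∣ 2 := Nat.not_dvd_of_pos_of_lt (by omega) (by omega)
  have hS : DivPow p 1 (2 * ∑ j ∈ range (p - 1), s j * ((r j)⁻¹) ^ 2) := by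
    have h : 2 * ∑ j ∈ range (p - 1), s j * ((r j)⁻¹) ^ 2
        = 2 * ∑ j ∈ range (p - 1), ((r j)⁻¹) ^ 2 + ∑ j ∈ range (p - 1),
          (p : ℚ) * ((2 - s j) * (2 * r j - p) *
            (((p : ℚ) - r j)⁻¹ * ((p : ℚ) - r j)⁻¹ * ((r j)⁻¹ * (r j)⁻¹))) := by
      rw [two_mul_sum_eq_sum_add_reflect, mul_sum, ← sum_add_distrib]
      refine sum_congr rfl fun j hj => ?_
      rw [(hrefl j hj).1, (hrefl j hj).2]
      obtain ⟨h1, h2⟩ := hr0 j hj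
      field_simp
      ring
    rw [h]
    refine (htwo.integral_mul hH).add (DivPow.sum fun j hj => DivPow.prime.mul_integral ?_)
    exact ((htwo.sub (hsi j)).mul ((htwo.mul (hri2 j)).sub (DivPow.natCast p))).mul
      (((hri' j hj).mul (hri' j hj)).mul ((hri j hj).mul (hri j hj)))
  refine DivPow.of_natCast_mul hnd2 ?_
  have h : ((2 : ℕ) : ℚ) * (∑ j ∈ range (p - 1), s j * (r j)⁻¹
      - p / 2 * ∑ j ∈ range (p - 1), (s j * (r j)⁻¹) ^ 2
      - 2 * ∑ j ∈ range (p - 1), s j * (s j - 1) / 2 * (r j)⁻¹)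
      = (p : ℚ) * (∑ j ∈ range (p - 1), (p : ℚ) * ((2 * s j - s j * s j) *
          ((r j)⁻¹ * (r j)⁻¹ * ((p : ℚ) - r j)⁻¹))
        - 2 * ∑ j ∈ range (p - 1), s j * ((r j)⁻¹) ^ 2) := by
    have h1 : ((2 : ℕ) : ℚ) * (∑ j ∈ range (p - 1), s j * (r j)⁻¹
        - p / 2 * ∑ j ∈ range (p - 1), (s j * (r j)⁻¹) ^ 2
        - 2 * ∑ j ∈ range (p - 1), s j * (s j - 1) / 2 * (r j)⁻¹)
        = 2 * ∑ j ∈ range (p - 1), (2 * s j - s j * s j) * (r j)⁻¹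
          - p * ∑ j ∈ range (p - 1), (s j * (r j)⁻¹) ^ 2 := by
      simp only [mul_sum, ← sum_sub_distrib]
      refine sum_congr rfl fun j _ => ?_
      push_cast
      ring
    rw [h1, two_mul_sum_eq_sum_add_reflect]
    simp only [mul_sum, ← sum_sub_distrib]
    refine sum_congr rfl fun j hj => ?_
    rw [(hrefl j hj).1, (hrefl j hj).2]
    obtain ⟨h1, h2⟩ := hr0 j hj
    field_simp
    ring
  rw [h]
  refine DivPow.prime.mul (m := 1) (n := 1) (DivPow.sub (DivPow.sum fun j hj => ?_) hS)
  exact DivPow.prime.mul_integral (((htwo.mul (hsi j)).sub ((hsi j).mul (hsi j))).mul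
    (((hri j hj).mul (hri j hj)).mul (hri' j hj)))

/-- With `q` the Fermat quotient of `3`, `q - p q² / 2 ≡ 2 ∑ 1 / (p - 3 i)` modulo `p²`, the sum
being over `1 ≤ i ≤ p / 3`. -/
theorem divPow_fermatQuotient_three_sub (h3 : 3 < p) :
    DivPow p 2 (((3 : ℚ) ^ (p - 1) - 1) / p - p / 2 * (((3 : ℚ) ^ (p - 1) - 1) / p) ^ 2
      - 2 * ∑ i ∈ range (p / 3), ((p : ℚ) - 3 * (i + 1))⁻¹) := by
  have hp0 : (p : ℚ) ≠ 0 := by exact_mod_cast hp.out.ne_zero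
  have hhalf : DivPow p 0 ((2 : ℚ)⁻¹) := by
    exact_mod_cast DivPow.inv_natCast (p := p) (Nat.not_dvd_of_pos_of_lt two_pos (by omega))
  have htwo : DivPow p 0 (2 : ℚ) := by exact_mod_cast DivPow.natCast (p := p) 2
  have hlog := divPow_log_three_sub h3
  have hx : ∀ j ∈ range (p - 1), DivPow p 0
      (((3 * (j + 1) / p : ℕ) : ℚ) * ((3 * (j + 1) % p : ℕ) : ℚ)⁻¹) := by
    intro j hj
    obtain ⟨h1, h2, -⟩ := three_mul_divMod h3 (mem_range.mp hj)
    exact (DivPow.natCast _).mul (DivPow.inv_natCast (Nat.not_dvd_of_pos_of_lt h1 h2))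
  have hprod := divPow_prod_one_add_prime_mul (by omega) _ hx
  rw [← three_pow_eq_prod h3] at hprod
  have hE := DivPow.sum hx
  have hQ : DivPow p 0 (∑ j ∈ range (p - 1),
      (((3 * (j + 1) / p : ℕ) : ℚ) * ((3 * (j + 1) % p : ℕ) : ℚ)⁻¹) ^ 2) :=
    DivPow.sum fun j hj => by
      rw [pow_two]
      exact (hx j hj).mul (hx j hj)
  generalize ∑ j ∈ range (p - 1),
    ((3 * (j + 1) / p : ℕ) : ℚ) * ((3 * (j + 1) % p : ℕ) : ℚ)⁻¹ = E at *
  generalize ∑ j ∈ range (p - 1),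
    (((3 * (j + 1) / p : ℕ) : ℚ) * ((3 * (j + 1) % p : ℕ) : ℚ)⁻¹) ^ 2 = Q at *
  generalize ∑ i ∈ range (p / 3), ((p : ℚ) - 3 * (i + 1))⁻¹ = A at *
  obtain ⟨q, hq⟩ : ∃ q : ℚ, ((3 : ℚ) ^ (p - 1) - 1) / p = q := ⟨_, rfl⟩
  rw [hq]
  have hq' : (3 : ℚ) ^ (p - 1) = 1 + p * q := by
    rw [← hq]
    field_simp
    ring
  rw [hq'] at hprod
  have h1 : DivPow p 2 (q - E - p * ((E * E - Q) * 2⁻¹)) := by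
    refine DivPow.of_prime_mul ?_
    convert hprod using 1
    ring
  have h2 : DivPow p 1 (q - E) := by
    have := (h1.mono one_le_two).add
      (DivPow.prime.mul_integral (((hE.mul hE).sub hQ).mul hhalf))
    convert this using 1
    ring
  have h4 : DivPow p 0 (q + E) := by
    convert (h2.mono zero_le_one).add (htwo.mul hE) using 1
    ring
  have h5 : DivPow p 2 ((p : ℚ) * (q - E) * (2⁻¹ * (q + E))) :=
    (DivPow.prime.mul h2).mul_integral (hhalf.mul h4)
  convert (h1.add hlog).sub h5 using 1
  ring

theorem divPow_sinProd_sub_one {b : ℚ} (hb : DivPow p 1 b) {k : ℕ} (hk : k ≤ p - 1) :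
    DivPow p 1 (sinProd b k - 1) := by
  induction k with
  | zero => simpa [sinProd] using DivPow.zero
  | succ k ih =>
    have h1 := ih (by omega)
    have h2 : DivPow p 0 (sinProd b k) := by
      convert (h1.mono zero_le_one).add DivPow.one using 1
      ring
    have hi := DivPow.inv_succ (p := p) (j := k) (by omega)
    rw [sinProd_succ]
    convert h1.sub (hb.mul_integral (((hb.mono zero_le_one).mul (hi.mul hi)).mul h2)) using 1
    field_simp
    ring

theorem divPow_sum_legTerm_mul {b : ℚ} (hb : DivPow p 1 b) {w : ℕ → ℚ}
    (hw : ∀ k < p - 1, DivPow p 0 (w k))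
    (hsum : DivPow p 1 (∑ k ∈ range (p - 1), w k / ((k : ℚ) + 1))) :
    DivPow p 2 (∑ k ∈ range (p - 1), legTerm b (k + 1) * w k) := by
  have hb0 := hb.mono zero_le_one
  have h : ∑ k ∈ range (p - 1), legTerm b (k + 1) * w k
      = -(b * (∑ k ∈ range (p - 1), w k / ((k : ℚ) + 1) + ∑ k ∈ range (p - 1),
          ((sinProd b k - 1) * (w k * ((k : ℚ) + 1)⁻¹)
            + b * (w k * sinProd b k * (((k : ℚ) + 1)⁻¹ * ((k : ℚ) + 1)⁻¹))))) := by
    rw [← sum_add_distrib, mul_sum, ← sum_neg_distrib]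
    refine sum_congr rfl fun k _ => ?_
    have h1 : (k : ℚ) + 1 ≠ 0 := by positivity
    rw [legTerm_succ]
    field_simp
    ring
  rw [h]
  refine (hb.mul (n := 1) (hsum.add (DivPow.sum fun k hk => ?_))).neg
  have hk' := mem_range.mp hk
  have h1 := divPow_sinProd_sub_one hb hk'.le
  have h2 : DivPow p 0 (sinProd b k) := by
    convert (h1.mono zero_le_one).add DivPow.one using 1
    ring
  have hi := DivPow.inv_succ hk'
  exact (h1.mul_integral ((hw k hk').mul hi)).add
    (hb.mul_integral (((hw k hk').mul h2).mul (hi.mul hi)))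

theorem divPow_sum_legTerm_sub_one (h3 : 3 < p) {b : ℚ} (hb : DivPow p 1 b) :
    DivPow p 2 (∑ k ∈ range (p - 1 + 1), legTerm b k - 1) := by
  rw [sum_range_succ']
  have := divPow_sum_legTerm_mul hb (w := fun _ => 1) (fun _ _ => DivPow.one)
    (divPow_harm_pred (by omega))
  simpa [legTerm] using this

theorem divPow_sum_legTerm_mul_harm (h3 : 3 < p) {b : ℚ} (hb : DivPow p 1 b) :
    DivPow p 2 (∑ k ∈ range (p - 1 + 1), legTerm b k * harm k) := by
  rw [sum_range_succ']
  have hnd2 : ¬ p ∣ 2 := Nat.not_dvd_of_pos_of_lt (by omega) (by omega)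
  have hH := divPow_harm_pred (p := p) (by omega)
  have := divPow_sum_legTerm_mul hb (w := fun k => harm (k + 1))
    (fun k hk => divPow_harm_of_le (by omega)) (by
      refine DivPow.of_natCast_mul hnd2 ?_
      push_cast
      rw [sum_harm_div, pow_two]
      exact (hH.mul_integral (hH.mono zero_le_one)).add (divPow_harm2_pred h3))
  simpa [harm] using this

/-- `p²` divides `∏_{j<p} (1 - c²/j²)` when `c` is congruent to a nonzero residue. -/
theorem divPow_sinProd {b : ℚ} (hb : DivPow p 1 b) {i : ℕ} (hi : i < p - 1) :
    DivPow p 2 (sinProd (b + (i + 1)) (p - 1)) := by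
  have hc : DivPow p 0 (b + (i + 1)) :=
    (hb.mono zero_le_one).add (by exact_mod_cast DivPow.natCast (p := p) (i + 1))
  have h : sinProd (b + (i + 1)) (p - 1)
      = (∏ j ∈ range (p - 1), (1 - (b + (i + 1)) * ((j : ℚ) + 1)⁻¹))
        * ∏ j ∈ range (p - 1), (1 + (b + (i + 1)) * ((j : ℚ) + 1)⁻¹) := by
    rw [← prod_mul_distrib, sinProd]
    refine prod_congr rfl fun j _ => ?_
    have h1 : (j : ℚ) + 1 ≠ 0 := by positivity
    field_simp
    ring
  rw [h]
  refine DivPow.mul (m := 1) (n := 1)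
    (DivPow.prod_of_mem (i := i) (mem_range.mpr hi) ?_ fun j hj => ?_)
    (DivPow.prod_of_mem (i := p - 1 - 1 - i) (mem_range.mpr (by omega)) ?_ fun j hj => ?_)
  · convert (hb.mul_integral (DivPow.inv_succ hi)).neg using 1
    have h1 : (i : ℚ) + 1 ≠ 0 := by positivity
    field_simp
    ring
  · exact DivPow.one.sub (hc.mul (DivPow.inv_succ (mem_range.mp hj)))
  · convert (hb.add DivPow.prime).mul_integral
      (DivPow.inv_succ (p := p) (j := p - 1 - 1 - i) (by omega)) using 1
    have h1 : ((p - 1 - 1 - i : ℕ) : ℚ) + 1 ≠ 0 := by positivity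
    field_simp
    rw [cast_reflect hi]
    ring
  · exact DivPow.one.add (hc.mul (DivPow.inv_succ (mem_range.mp hj)))

theorem divPow_sum_legTerm_shift (h3 : 3 < p) {b : ℚ} (hb : DivPow p 1 b) {m : ℕ}
    (hm : m ≤ p - 1) :
    DivPow p 2 (∑ k ∈ range (p - 1 + 1), legTerm (b + m) k - (-1) ^ m) := by
  induction m with
  | zero => simpa using divPow_sum_legTerm_sub_one h3 hb
  | succ m ih =>
    have h1 := sum_legTerm_add (b + (m + 1)) (p - 1)
    have htwo : DivPow p 0 (2 : ℚ) := by exact_mod_cast DivPow.natCast (p := p) 2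
    have h2 := htwo.integral_mul (divPow_sinProd hb (i := m) (by omega))
    rw [← h1, show b + (m + 1 : ℚ) - 1 = b + m by ring] at h2
    convert h2.sub (ih (by omega)) using 1
    push_cast
    ring

theorem divPow_sum_legTerm_mul_harm_shift (h3 : 3 < p) {b : ℚ} (hb : DivPow p 1 b) {m : ℕ}
    (hm : m ≤ p - 1) (hinv : ∀ i < m, DivPow p 0 (b + (i + 1))⁻¹)
    (hne : ∀ i < m, b + (i + 1) ≠ 0) :
    DivPow p 2 (∑ k ∈ range (p - 1 + 1), legTerm (b + m) k * harm k
      - (-1) ^ m * (2 * ∑ i ∈ range m, (b + (i + 1))⁻¹)) := by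
  induction m with
  | zero => simpa using divPow_sum_legTerm_mul_harm h3 hb
  | succ m ih =>
    have htwo : DivPow p 0 (2 : ℚ) := by exact_mod_cast DivPow.natCast (p := p) 2
    have ih' := ih (by omega) (fun i hi => hinv i (by omega)) (fun i hi => hne i (by omega))
    have h1 := sum_legTerm_mul_harm_add (b + (m + 1)) (p - 1)
    rw [show b + (m + 1 : ℚ) - 1 = b + m by ring] at h1
    have hP := divPow_sinProd hb (i := m) (by omega)
    have hA := divPow_sum_legTerm_shift h3 hb hm
    have hH := divPow_harm_of_le (p := p) le_rfl
    have hc : DivPow p 0 (b + (m + 1)) :=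
      (hb.mono zero_le_one).add (by exact_mod_cast DivPow.natCast (p := p) (m + 1))
    have hci := hinv m (by omega)
    have hc0 := hne m (by omega)
    push_cast at *
    rw [sum_range_succ (fun i : ℕ => (b + ((i : ℚ) + 1))⁻¹)]
    have h2 := (htwo.mul hci).integral_mul
      ((((hc.integral_mul hP).mul_integral hH).sub hP).add hA)
    convert h2.sub ih' using 1
    generalize ∑ k ∈ range (p - 1 + 1), legTerm (b + (m + 1)) k * harm k = F at *
    generalize ∑ k ∈ range (p - 1 + 1), legTerm (b + m) k * harm k = F' at *
    have h5 : F = (b + (m + 1))⁻¹ * ((b + (m + 1)) * (F + F')) - F' := by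
      rw [inv_mul_cancel_left₀ hc0]
      ring
    rw [h5, h1]
    ring

end Congruences

theorem stmt_6 (p : ℕ) (hp : p.Prime) (hp3 : 3 < p) :
    CongrMod p 2
      ((if p % 3 = 1 then (1 : ℚ) else -1) *
        ∑ k ∈ Finset.range p,
          (Nat.choose (2 * k) k : ℚ) * (Nat.choose (3 * k) k) / 27 ^ k * harm k)
      (-3 * (((3 : ℚ) ^ (p - 1) - 1) / p) +
        3 / 2 * p * (((3 : ℚ) ^ (p - 1) - 1) / p) ^ 2) := by
  have : Fact p.Prime := ⟨hp⟩
  refine DivPow.congrMod ?_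
  have hnd : ¬ p ∣ 3 := Nat.not_dvd_of_pos_of_lt (by omega) hp3
  have hmod : p % 3 = 1 ∨ p % 3 = 2 := by
    have h : p % 3 ≠ 0 := by
      intro h
      have := (Nat.prime_dvd_prime_iff_eq Nat.prime_three hp).mp (Nat.dvd_of_mod_eq_zero h)
      omega
    omega
  have hthree : DivPow p 0 (3 : ℚ) := by exact_mod_cast DivPow.natCast (p := p) 3
  have hthird : DivPow p 0 ((3 : ℚ)⁻¹) := by exact_mod_cast DivPow.inv_natCast hnd
  have hb : DivPow p 1 (-(p : ℚ) * 3⁻¹) := DivPow.prime.neg.mul_integral hthird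
  have hpos : ∀ i < p / 3, 0 < (p : ℚ) - 3 * (i + 1) := by
    intro i hi
    rw [sub_pos]
    exact_mod_cast (show 3 * (i + 1) < p by omega)
  have hrw : ∀ i : ℕ, -(p : ℚ) * 3⁻¹ + (i + 1) = ((p : ℚ) - 3 * (i + 1)) * (-3⁻¹) := by
    intro i
    ring
  have hinv : ∀ i < p / 3, DivPow p 0 (-(p : ℚ) * 3⁻¹ + (i + 1))⁻¹ := by
    intro i hi
    rw [hrw, mul_inv]
    refine DivPow.mul (m := 0) (n := 0) ?_ (by simpa using hthree.neg)
    have := DivPow.inv_natCast (p := p) (z := p - 3 * (i + 1))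
      (Nat.not_dvd_of_pos_of_lt (by omega) (by omega))
    rw [Nat.cast_sub (by omega)] at this
    exact_mod_cast this
  have hne : ∀ i < p / 3, -(p : ℚ) * 3⁻¹ + (i + 1) ≠ 0 := by
    intro i hi
    rw [hrw]
    exact mul_ne_zero (hpos i hi).ne' (by norm_num)
  have hF := divPow_sum_legTerm_mul_harm_shift hp3 hb (m := p / 3) (by omega) hinv hne
  have hq := divPow_fermatQuotient_three_sub hp3
  have hsum : ∑ i ∈ range (p / 3), (-(p : ℚ) * 3⁻¹ + (i + 1))⁻¹
      = -3 * ∑ i ∈ range (p / 3), ((p : ℚ) - 3 * (i + 1))⁻¹ := by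
    rw [mul_sum]
    refine sum_congr rfl fun i _ => ?_
    rw [hrw, mul_inv, inv_neg, inv_inv]
    ring
  have hterm : ∀ k, legTerm (-(p : ℚ) * 3⁻¹ + (p / 3 : ℕ)) k = legTerm (-1 / 3) k := by
    intro k
    have h := Nat.mod_add_div p 3
    have h' : ((p % 3 : ℕ) : ℚ) + 3 * (p / 3 : ℕ) = p := by exact_mod_cast h
    rcases hmod with h1 | h1
    · rw [h1] at h'
      congr 1
      rw [← h']
      push_cast
      ring
    · rw [h1] at h'
      rw [← legTerm_neg_one_sub]
      congr 1
      nth_rewrite 1 [← h']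
      push_cast
      ring
  have hsign : (if p % 3 = 1 then (1 : ℚ) else -1) = (-1) ^ (p / 3) := by
    have hodd := hp.eq_two_or_odd
    rcases hmod with h1 | h1
    · rw [if_pos h1, Even.neg_one_pow (Nat.even_iff.mpr (by omega))]
    · rw [if_neg (by omega), Odd.neg_one_pow (Nat.odd_iff.mpr (by omega))]
  have hsq : ((-1 : ℚ) ^ (p / 3)) * (-1) ^ (p / 3) = 1 := by
    rw [← mul_pow]
    norm_num
  have hsignI : DivPow p 0 ((-1 : ℚ) ^ (p / 3)) := by
    exact_mod_cast DivPow.intCast (p := p) ((-1) ^ (p / 3))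
  have hsumF : ∑ k ∈ range p, (Nat.choose (2 * k) k : ℚ) * (Nat.choose (3 * k) k) / 27 ^ k * harm k
      = ∑ k ∈ range (p - 1 + 1), legTerm (-(p : ℚ) * 3⁻¹ + (p / 3 : ℕ)) k * harm k := by
    rw [Nat.sub_add_cancel hp.one_le]
    refine sum_congr rfl fun k _ => ?_
    rw [choose_mul_choose_div_eq_legTerm, hterm]
  rw [hsum] at hF
  rw [hsign, hsumF]
  generalize ∑ k ∈ range (p - 1 + 1), legTerm (-(p : ℚ) * 3⁻¹ + (p / 3 : ℕ)) k * harm k = F at *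
  generalize ∑ i ∈ range (p / 3), ((p : ℚ) - 3 * (i + 1))⁻¹ = A at *
  generalize ((3 : ℚ) ^ (p - 1) - 1) / p = q at *
  generalize (-1 : ℚ) ^ (p / 3) = e at *
  convert (hsignI.integral_mul hF).add (hthree.integral_mul hq) using 1
  linear_combination (6 * A) * (-hsq)
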